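/- Let a : ℕ → ℝ be nonnegative and summable with effective dimension N(τ) := ∑'_j a_j/(a_j+τ), let σ > 0, let M ≥ 2 be an integer, and let φ be a nonnegative nondecreasing function. Define J(τ) := √(log M)·σ²·√(N(τ))/τ + (log M)·σ²/τ + φ²(τ). Suppose τ_min > 0 satisfies √(log M)·σ²·√(N(τ_min))/τ_min ≥ 1, and that φ(τ_min) ≤ 1. Then for every τ with 0 < τ ≤ τ_min, J(τ) ≥ (1/2) · J(τ_min). (Thus, under minimal smoothness of the alternative, restricting the adaptive grid to parameters above τ_min loses at most a factor 2.) -/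

import Mathlib

/-- The terms of the effective dimension are summable. -/
theorem summable_div_add {a : ℕ → ℝ} (ha : ∀ j, 0 ≤ a j) (hsum : Summable a)
    {τ : ℝ} (hτ : 0 < τ) : Summable fun j => a j / (a j + τ) := by
  refine Summable.of_nonneg_of_le (fun j => div_nonneg (ha j) (add_nonneg (ha j) hτ.le))
    (fun j => ?_) (hsum.div_const τ)
  exact div_le_div_of_nonneg_left (ha j) hτ (le_add_of_nonneg_left (ha j))

/-- The effective dimension is antitone in the regularization parameter. -/
theorem tsum_div_add_le {a : ℕ → ℝ} (ha : ∀ j, 0 ≤ a j) (hsum : Summable a)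
    {τ τ' : ℝ} (hτ : 0 < τ) (h : τ ≤ τ') :
    ∑' j, a j / (a j + τ') ≤ ∑' j, a j / (a j + τ) := by
  refine (summable_div_add ha hsum (hτ.trans_le h)).tsum_le_tsum (fun j => ?_)
    (summable_div_add ha hsum hτ)
  exact div_le_div_of_nonneg_left (ha j) (add_pos_of_nonneg_of_pos (ha j) hτ) (by gcongr)

/-- Under minimal smoothness of the alternative, restricting the adaptive grid to
parameters above `τ_min` loses at most a factor 2: if
`√(log M) σ² √(N(τ_min))/τ_min ≥ 1` and `φ(τ_min) ≤ 1`, then for all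
`0 < τ ≤ τ_min`, `J(τ) ≥ J(τ_min)/2`, where
`J(τ) = √(log M) σ² √(N(τ))/τ + (log M) σ²/τ + φ²(τ)`. -/
theorem stmt_15
    (a : ℕ → ℝ) (ha : ∀ j, 0 ≤ a j) (hsum : Summable a)
    (N : ℝ → ℝ) (hN : ∀ τ, N τ = ∑' j, a j / (a j + τ))
    (σ : ℝ) (hσ : 0 < σ) (M : ℕ) (hM : 2 ≤ M)
    (φ : ℝ → ℝ) (hφ0 : ∀ t, 0 ≤ φ t) (hφmono : Monotone φ)
    (J : ℝ → ℝ)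
    (hJ : ∀ τ, J τ = Real.sqrt (Real.log M) * σ ^ 2 * Real.sqrt (N τ) / τ
      + Real.log M * σ ^ 2 / τ + φ τ ^ 2)
    (τmin : ℝ) (hτmin : 0 < τmin)
    (hstoch : 1 ≤ Real.sqrt (Real.log M) * σ ^ 2 * Real.sqrt (N τmin) / τmin)
    (hsmooth : φ τmin ≤ 1) :
    ∀ τ : ℝ, 0 < τ → τ ≤ τmin → (1 / 2) * J τmin ≤ J τ := by
  intro τ hτ hle
  have hlog : 0 ≤ Real.log M := Real.log_natCast_nonneg M
  have hNle : N τmin ≤ N τ := by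
    rw [hN, hN]
    exact tsum_div_add_le ha hsum hτ hle
  have hdim : Real.sqrt (Real.log M) * σ ^ 2 * Real.sqrt (N τmin) / τmin
      ≤ Real.sqrt (Real.log M) * σ ^ 2 * Real.sqrt (N τ) / τ := by
    gcongr
  have hinv : Real.log M * σ ^ 2 / τmin ≤ Real.log M * σ ^ 2 / τ := by
    gcongr
  have hnonneg : 0 ≤ Real.log M * σ ^ 2 / τmin := by positivity
  have hsq : φ τmin ^ 2 ≤ 1 := pow_le_one₀ (hφ0 τmin) hsmooth
  rw [hJ, hJ]
  linarith [sq_nonneg (φ τ)]
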